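/- Let d = 3 and suppose q = (q̄, q_n(q̄)) is a normalized central configuration satisfying the normalization y_{n−1} = z_{n−1} = z_{n−2} = 0. Assume x_{n−1} − x_n ≠ 0, x_{n−1} ≠ 0, y_{n−2} ≠ 0, and det [[y_{n−2} − y_n, y_{n−1} − y_n], [x_{n−2} − x_n, x_{n−1} − x_n]] ≠ 0. Then rank(DF(q)) = 3n − 3 if and only if the Jacobian matrix D RS at the corresponding point is invertible (equivalently, has rank 3n − 6). -/

import Mathlib

open scoped BigOperators

noncomputable section

/-- Points in `ℝ^d`, with the Euclidean norm. -/
abbrev Pt (d : ℕ) := EuclideanSpace ℝ (Fin d)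

/-- `F_i(q) = −q_i + Σ_{j ≠ i} m_j (q_j − q_i)/‖q_j − q_i‖³`. -/
noncomputable def nbodyF {d n : ℕ} (m : Fin n → ℝ) (q : Fin n → Pt d) : Fin n → Pt d :=
  fun i => -q i + ∑ j ∈ Finset.univ.erase i, (m j / ‖q j - q i‖ ^ 3) • (q j - q i)

/-- A configuration is collision-free if all bodies occupy distinct positions. -/
def CollisionFree {d n : ℕ} (q : Fin n → Pt d) : Prop :=
  ∀ i j, i ≠ j → q i ≠ q j

/-- A normalized central configuration: collision-free, center of mass at the origin,
and `F(q) = 0`. -/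
def IsNCC {d n : ℕ} (m : Fin n → ℝ) (q : Fin n → Pt d) : Prop :=
  CollisionFree q ∧ (∑ i, m i • q i) = 0 ∧ nbodyF m q = 0

/-- Embedding of the reduced index set `{1,…,n−1}` into `{1,…,n}`. -/
def emb {n : ℕ} (i : Fin (n - 1)) : Fin n := Fin.castLE (Nat.sub_le n 1) i

/-- Extend a reduced configuration `q̄ = (q_1,…,q_{n−1})` by the position of the last body,
`q_n(q̄) = −(1/m_n) Σ_{i<n} m_i q_i`, computed from the center of mass condition. -/
noncomputable def extendConfig {d n : ℕ} (m : Fin n → ℝ) (qbar : Fin (n - 1) → Pt d) :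
    Fin n → Pt d :=
  fun i => if h : (i : ℕ) < n - 1 then qbar ⟨i, h⟩
    else (-(1 / m i)) • ∑ j : Fin (n - 1), m (emb j) • qbar j

/-- The center-of-mass reduced map `F^red_i(q̄) = F_i(q_1,…,q_{n−1},q_n(q̄))`, `i = 1,…,n−1`. -/
noncomputable def Fred {d n : ℕ} (m : Fin n → ℝ) (qbar : Fin (n - 1) → Pt d) :
    Fin (n - 1) → Pt d :=
  fun i => nbodyF m (extendConfig m qbar) (emb i)

/-- The Jacobian matrix of `F`, rows and columns indexed by (body, coordinate). -/
noncomputable def jacF {d n : ℕ} (m : Fin n → ℝ) (q : Fin n → Pt d) :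
    Matrix (Fin n × Fin d) (Fin n × Fin d) ℝ :=
  fun p p' =>
    fderiv ℝ (fun q' : Fin n → Pt d => nbodyF m q' p.1 p.2) q
      (Pi.single p'.1 (EuclideanSpace.single p'.2 (1 : ℝ)))

/-- The Jacobian matrix of `F^red`, rows and columns indexed by (body, coordinate). -/
noncomputable def jacFred {d n : ℕ} (m : Fin n → ℝ) (qbar : Fin (n - 1) → Pt d) :
    Matrix (Fin (n - 1) × Fin d) (Fin (n - 1) × Fin d) ℝ :=
  fun p p' =>
    fderiv ℝ (fun q' : Fin (n - 1) → Pt d => Fred m q' p.1 p.2) qbar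
      (Pi.single p'.1 (EuclideanSpace.single p'.2 (1 : ℝ)))

/-- The Jacobian matrix of the spatial reduced system `RS`: it is obtained from `DF^red`
by removing the rows corresponding to `F^red_{n−1,y}`, `F^red_{n−1,z}`, `F^red_{n−2,z}` and
the columns corresponding to the variables `y_{n−1}`, `z_{n−1}`, `z_{n−2}`
(here `x = 0`, `y = 1`, `z = 2`; the bodies of paper-index `n−1`, `n−2` are `⟨n−2,_⟩`, `⟨n−3,_⟩`). -/
noncomputable def DRS3 {n : ℕ} (hn : 4 ≤ n) (m : Fin n → ℝ) (qbar : Fin (n - 1) → Pt 3) :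
    Matrix
      {p : Fin (n - 1) × Fin 3 //
        p ≠ (⟨n - 2, by omega⟩, 1) ∧ p ≠ (⟨n - 2, by omega⟩, 2) ∧ p ≠ (⟨n - 3, by omega⟩, 2)}
      {p : Fin (n - 1) × Fin 3 //
        p ≠ (⟨n - 2, by omega⟩, 1) ∧ p ≠ (⟨n - 2, by omega⟩, 2) ∧ p ≠ (⟨n - 3, by omega⟩, 2)} ℝ :=
  (jacFred m qbar).submatrix Subtype.val Subtype.val

section Derivative

variable {d n : ℕ}

theorem differentiableAt_nbodyF (m : Fin n → ℝ) {q : Fin n → Pt d} (hq : CollisionFree q) :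
    DifferentiableAt ℝ (nbodyF m) q := by
  rw [differentiableAt_pi]
  intro i
  unfold nbodyF
  refine (differentiableAt_apply i q).neg.add (DifferentiableAt.fun_sum fun j hj => ?_)
  have hne : q j - q i ≠ 0 := sub_ne_zero.2 (hq j i (Finset.ne_of_mem_erase hj))
  have hd : DifferentiableAt ℝ (fun q : Fin n → Pt d => q j - q i) q := by fun_prop
  have hc : DifferentiableAt ℝ (fun q : Fin n → Pt d => m j / ‖q j - q i‖ ^ 3) q := by
    simp_rw [div_eq_mul_inv]
    have h3 := (hd.norm ℝ hne).fun_pow 3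
    exact (h3.fun_inv (pow_ne_zero _ (norm_ne_zero_iff.2 hne))).const_mul (m j)
  exact hc.fun_smul hd

theorem sum_erase_eq_zero_of_antisymm {E : Type*} [AddCommGroup E] [Module ℝ E]
    (f : Fin n → Fin n → E) (hf : ∀ i j, f j i = -f i j) :
    ∑ i, ∑ j ∈ Finset.univ.erase i, f i j = 0 := by
  have : IsAddTorsionFree E := .of_isTorsionFree ℝ E
  have h0 : ∀ i, f i i = 0 := fun i => self_eq_neg.1 (hf i i)
  have h1 : ∀ i, ∑ j ∈ Finset.univ.erase i, f i j = ∑ j, f i j := fun i =>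
    Finset.sum_erase _ (h0 i)
  simp_rw [h1]
  have h2 : ∑ i, ∑ j, f i j = -∑ i, ∑ j, f i j := by
    conv_lhs => rw [Finset.sum_comm]
    simp_rw [← Finset.sum_neg_distrib, ← hf]
  exact self_eq_neg.1 h2

theorem sum_smul_nbodyF (m : Fin n → ℝ) (q : Fin n → Pt d) :
    ∑ i, m i • nbodyF m q i = -∑ i, m i • q i := by
  have h := sum_erase_eq_zero_of_antisymm
    (fun i j => m i • (m j / ‖q j - q i‖ ^ 3) • (q j - q i)) (fun i j => by
      rw [norm_sub_rev (q i), ← neg_sub (q j) (q i)]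
      simp only [smul_smul, smul_neg]
      congr 2
      ring)
  simp only [nbodyF, smul_add, Finset.sum_add_distrib, smul_neg, Finset.sum_neg_distrib,
    Finset.smul_sum, h, add_zero]

theorem sum_angular_nbodyF (m : Fin n → ℝ) (q : Fin n → Pt d) (k l : Fin d) :
    ∑ i, m i * (q i k * nbodyF m q i l - q i l * nbodyF m q i k) = 0 := by
  have h := sum_erase_eq_zero_of_antisymm
    (fun i j => m i * m j / ‖q j - q i‖ ^ 3 * (q i k * q j l - q i l * q j k)) (fun i j => by
      rw [norm_sub_rev (q i)]
      ring)
  rw [← h]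
  refine Finset.sum_congr rfl fun i _ => ?_
  simp only [nbodyF, PiLp.add_apply, PiLp.neg_apply, WithLp.ofLp_sum, Finset.sum_apply,
    PiLp.smul_apply, PiLp.sub_apply, smul_eq_mul, mul_add, Finset.mul_sum]
  rw [add_sub_add_comm, ← Finset.sum_sub_distrib, mul_add, Finset.mul_sum]
  rw [show m i * (q i k * -q i l - q i l * -q i k) = 0 by ring, zero_add]
  refine Finset.sum_congr rfl fun j _ => ?_
  ring

theorem sum_smul_fderiv_nbodyF (m : Fin n → ℝ) {q : Fin n → Pt d} (hq : CollisionFree q)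
    (v : Fin n → Pt d) :
    ∑ i, m i • fderiv ℝ (nbodyF m) q v i = -∑ i, m i • v i := by
  let S : (Fin n → Pt d) →L[ℝ] Pt d := ∑ i, m i • ContinuousLinearMap.proj i
  have hS : ∀ w, S w = ∑ i, m i • w i := fun w => by simp [S]
  have h1 : HasFDerivAt (fun p => S (nbodyF m p)) (S ∘L fderiv ℝ (nbodyF m) q) q :=
    S.hasFDerivAt.comp q (differentiableAt_nbodyF m hq).hasFDerivAt
  have h2 : (fun p => S (nbodyF m p)) = fun p => (-S) p := by
    funext p
    simp [hS, sum_smul_nbodyF]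
  rw [h2] at h1
  have h3 := congrArg (fun T => T v) (h1.unique (-S).hasFDerivAt)
  simpa [hS] using h3

/-- The coordinate `k` of the body `i`, as a continuous linear functional. -/
def coordL {ι : Type*} (i : ι) (k : Fin d) : (ι → Pt d) →L[ℝ] ℝ :=
  (EuclideanSpace.proj k : Pt d →L[ℝ] ℝ) ∘L ContinuousLinearMap.proj i

theorem coordL_apply {ι : Type*} (i : ι) (k : Fin d) (v : ι → Pt d) : coordL i k v = v i k := rfl

theorem sum_angular_fderiv_nbodyF (m : Fin n → ℝ) {q : Fin n → Pt d} (hq : CollisionFree q)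
    (h0 : nbodyF m q = 0) (v : Fin n → Pt d) (k l : Fin d) :
    ∑ i, m i * (q i k * fderiv ℝ (nbodyF m) q v i l - q i l * fderiv ℝ (nbodyF m) q v i k)
      = 0 := by
  have hF := (differentiableAt_nbodyF m hq).hasFDerivAt
  have hc : ∀ i k, HasFDerivAt (fun p : Fin n → Pt d => p i k) (coordL i k) q := fun i k =>
    (coordL i k).hasFDerivAt
  have hf : ∀ i k, HasFDerivAt (fun p : Fin n → Pt d => nbodyF m p i k)
      (coordL i k ∘L fderiv ℝ (nbodyF m) q) q :=
    fun i k => (coordL i k).hasFDerivAt.comp q hF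
  have h1 := HasFDerivAt.fun_sum (u := Finset.univ) fun i _ =>
    ((((hc i k).mul (hf i l)).sub ((hc i l).mul (hf i k))).const_mul (m i))
  have h2 := h1.unique ((hasFDerivAt_const (0 : ℝ) q).congr_of_eventuallyEq
    (Filter.Eventually.of_forall fun p => sum_angular_nbodyF m p k l))
  have h3 := congrArg (fun T => T v) h2
  simpa [h0, sum_apply, coordL_apply] using h3

theorem hasDerivAt_inv_cube_smul {E : Type*} [NormedAddCommGroup E] [InnerProductSpace ℝ E]
    (c : ℝ) {u w : E} (hu : u ≠ 0) (huw : inner ℝ u w = 0) :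
    HasDerivAt (fun t : ℝ => (c / ‖u + t • w‖ ^ 3) • (u + t • w)) ((c / ‖u‖ ^ 3) • w) 0 := by
  have hl : HasDerivAt (fun t : ℝ => u + t • w) w 0 := by
    simpa using ((hasDerivAt_id (0 : ℝ)).smul_const w).const_add u
  have hsq : HasDerivAt (fun t : ℝ => ‖u + t • w‖ ^ 2) 0 0 := by
    simpa [huw] using hl.norm_sq
  have hn : HasDerivAt (fun t : ℝ => ‖u + t • w‖) 0 0 := by
    have := hsq.sqrt (by simpa using hu)
    simpa using this
  have hc : HasDerivAt (fun t : ℝ => c / ‖u + t • w‖ ^ 3) 0 0 := by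
    have := (hasDerivAt_const (0 : ℝ) c).fun_div (hn.fun_pow 3) (by simpa using hu)
    simpa using this
  simpa using hc.fun_smul hl

theorem fderiv_nbodyF_skew (m : Fin n → ℝ) {q : Fin n → Pt d} (hq : CollisionFree q)
    (h0 : nbodyF m q = 0) (Ω : Pt d →ₗ[ℝ] Pt d) (hΩ : ∀ x, inner ℝ x (Ω x) = 0) :
    fderiv ℝ (nbodyF m) q (fun i => Ω (q i)) = 0 := by
  set v : Fin n → Pt d := fun i => Ω (q i) with hv
  have hl : HasDerivAt (fun t : ℝ => q + t • v) v 0 := by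
    simpa using ((hasDerivAt_id (0 : ℝ)).smul_const v).const_add q
  have hF : HasDerivAt (fun t : ℝ => nbodyF m (q + t • v)) (fderiv ℝ (nbodyF m) q v) 0 := by
    have hF0 : HasFDerivAt (nbodyF m) (fderiv ℝ (nbodyF m) q) (q + (0 : ℝ) • v) := by
      simpa using (differentiableAt_nbodyF m hq).hasFDerivAt
    exact hF0.comp_hasDerivAt (0 : ℝ) hl
  rw [hasDerivAt_pi] at hF
  funext i
  have hi : HasDerivAt (fun t : ℝ => nbodyF m (q + t • v) i) (Ω (nbodyF m q i)) 0 := by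
    have h1 : HasDerivAt (fun t : ℝ => -(q + t • v) i) (-v i) 0 :=
      ((hasDerivAt_pi.1 hl) i).fun_neg
    have h2 := h1.fun_add (HasDerivAt.fun_sum (u := Finset.univ.erase i) fun j hj =>
      hasDerivAt_inv_cube_smul (m j) (sub_ne_zero.2 (hq j i (Finset.ne_of_mem_erase hj)))
        (hΩ (q j - q i)))
    have hfun : (fun t : ℝ => nbodyF m (q + t • v) i) = fun t => -(q + t • v) i +
        ∑ j ∈ Finset.univ.erase i, (m j / ‖q j - q i + t • Ω (q j - q i)‖ ^ 3) •
          (q j - q i + t • Ω (q j - q i)) := by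
      funext t
      simp only [nbodyF, hv, Pi.add_apply, Pi.smul_apply, map_sub]
      congr 1
      refine Finset.sum_congr rfl fun j _ => ?_
      rw [show q j + t • Ω (q j) - (q i + t • Ω (q i))
        = q j - q i + t • (Ω (q j) - Ω (q i)) by rw [smul_sub]; abel]
    have hval : Ω (nbodyF m q i) =
        -v i + ∑ j ∈ Finset.univ.erase i, (m j / ‖q j - q i‖ ^ 3) • Ω (q j - q i) := by
      simp only [nbodyF, hv, map_add, map_neg, map_sum, map_smul]
    rw [hfun, hval]
    exact h2
  rw [(hF i).unique hi, h0]
  simp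

end Derivative

section Reduction

variable {d n : ℕ}

theorem extendConfig_emb (m : Fin n → ℝ) (qbar : Fin (n - 1) → Pt d) (i : Fin (n - 1)) :
    extendConfig m qbar (emb i) = qbar i := by
  simp [extendConfig, emb]

theorem sum_univ_emb {M : Type*} [AddCommMonoid M] (hn : 0 < n) (f : Fin n → M) :
    ∑ i, f i = ∑ i : Fin (n - 1), f (emb i) + f ⟨n - 1, by omega⟩ := by
  obtain ⟨k, rfl⟩ : ∃ k, n = k + 1 := ⟨n - 1, by omega⟩
  exact Fin.sum_univ_castSucc f

/-- `extendConfig` as a continuous linear map. -/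
def extendConfigL (d : ℕ) (m : Fin n → ℝ) : (Fin (n - 1) → Pt d) →L[ℝ] (Fin n → Pt d) :=
  LinearMap.toContinuousLinearMap
    { toFun := extendConfig m
      map_add' := fun v w => by
        funext i
        by_cases h : (i : ℕ) < n - 1
        · simp [extendConfig, h]
        · simp [extendConfig, h, Finset.sum_add_distrib, smul_add]
      map_smul' := fun c v => by
        funext i
        by_cases h : (i : ℕ) < n - 1
        · simp [extendConfig, h]
        · simp only [extendConfig, h, dif_neg, not_false_eq_true, Pi.smul_apply,
            RingHom.id_apply, Finset.smul_sum, smul_smul]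
          refine Finset.sum_congr rfl fun j _ => ?_
          congr 1
          ring }

theorem extendConfigL_apply (m : Fin n → ℝ) (v : Fin (n - 1) → Pt d) :
    extendConfigL d m v = extendConfig m v := rfl

theorem extendConfig_comp_emb (hn : 0 < n) (m : Fin n → ℝ) (hm : ∀ i, 0 < m i)
    (v : Fin n → Pt d) (hv : ∑ i, m i • v i = 0) :
    extendConfig m (fun i => v (emb i)) = v := by
  funext i
  by_cases h : (i : ℕ) < n - 1
  · simp [extendConfig, h, emb]
  · have hi : i = ⟨n - 1, by omega⟩ := Fin.ext (by have := i.2; simp; omega)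
    rw [sum_univ_emb hn, ← hi] at hv
    simp only [extendConfig, h, dif_neg, not_false_eq_true]
    rw [eq_neg_of_add_eq_zero_left hv, smul_neg, neg_smul, neg_neg, smul_smul,
      one_div_mul_cancel (hm i).ne', one_smul]

theorem sum_smul_extendConfig (hn : 0 < n) (m : Fin n → ℝ) (hm : ∀ i, 0 < m i)
    (v : Fin (n - 1) → Pt d) : ∑ i, m i • extendConfig m v i = 0 := by
  rw [sum_univ_emb hn]
  simp only [extendConfig_emb]
  simp [extendConfig, (hm _).ne', smul_smul]

/-- The configuration with given coordinates. -/
def ofCoords {ι : Type*} (x : ι × Fin d → ℝ) : ι → Pt d :=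
  fun i => WithLp.toLp 2 fun k => x (i, k)

theorem ofCoords_eq_sum {ι : Type*} [Fintype ι] [DecidableEq ι] (x : ι × Fin d → ℝ) :
    ofCoords x =
      ∑ p : ι × Fin d, x p • (Pi.single p.1 (EuclideanSpace.single p.2 (1 : ℝ)) : ι → Pt d) := by
  funext i
  ext k
  simp only [ofCoords, Finset.sum_apply, WithLp.ofLp_sum, Pi.smul_apply, PiLp.smul_apply]
  rw [Finset.sum_eq_single (i, k)]
  · simp
  · rintro ⟨j, l⟩ _ hne
    by_cases hj : i = j
    · subst hj
      have : k ≠ l := fun h => hne (by rw [h])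
      simp [this]
    · simp [Pi.single_eq_of_ne hj]
  · simp

theorem jacF_mulVec (m : Fin n → ℝ) {q : Fin n → Pt d} (hq : CollisionFree q)
    (x : Fin n × Fin d → ℝ) (p : Fin n × Fin d) :
    (jacF m q).mulVec x p = fderiv ℝ (nbodyF m) q (ofCoords x) p.1 p.2 := by
  let π : (Fin n → Pt d) →L[ℝ] ℝ := coordL p.1 p.2
  have h : fderiv ℝ (fun q' : Fin n → Pt d => nbodyF m q' p.1 p.2) q
      = π ∘L fderiv ℝ (nbodyF m) q :=
    (π.hasFDerivAt.comp q (differentiableAt_nbodyF m hq).hasFDerivAt).fderiv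
  change ∑ p', fderiv ℝ (fun q' : Fin n → Pt d => nbodyF m q' p.1 p.2) q _ * x p'
    = π (fderiv ℝ (nbodyF m) q (ofCoords x))
  rw [h, ofCoords_eq_sum, map_sum, map_sum]
  simp [mul_comm]

theorem jacFred_mulVec (m : Fin n → ℝ) {qbar : Fin (n - 1) → Pt d}
    (hq : CollisionFree (extendConfig m qbar))
    (x : Fin (n - 1) × Fin d → ℝ) (p : Fin (n - 1) × Fin d) :
    (jacFred m qbar).mulVec x p
      = fderiv ℝ (nbodyF m) (extendConfig m qbar) (extendConfig m (ofCoords x)) (emb p.1) p.2 := by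
  let π : (Fin n → Pt d) →L[ℝ] ℝ := coordL (emb p.1) p.2
  have h : fderiv ℝ (fun q' : Fin (n - 1) → Pt d => Fred m q' p.1 p.2) qbar
      = π ∘L fderiv ℝ (nbodyF m) (extendConfig m qbar) ∘L extendConfigL d m :=
    (π.hasFDerivAt.comp qbar ((differentiableAt_nbodyF m hq).hasFDerivAt.comp qbar
      (extendConfigL d m).hasFDerivAt)).fderiv
  change ∑ p', fderiv ℝ (fun q' : Fin (n - 1) → Pt d => Fred m q' p.1 p.2) qbar _ * x p'
    = π (fderiv ℝ (nbodyF m) (extendConfig m qbar) (extendConfigL d m (ofCoords x)))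
  rw [h, ofCoords_eq_sum, map_sum, map_sum, map_sum]
  simp [mul_comm]

end Reduction

/-- The infinitesimal rotation `x ↦ w × x`. -/
def infRot (w : Fin 3 → ℝ) : Pt 3 →ₗ[ℝ] Pt 3 :=
  (WithLp.linearEquiv 2 ℝ (Fin 3 → ℝ)).symm.toLinearMap ∘ₗ crossProduct w ∘ₗ
    (WithLp.linearEquiv 2 ℝ (Fin 3 → ℝ)).toLinearMap

theorem infRot_apply (w : Fin 3 → ℝ) (x : Pt 3) :
    infRot w x = WithLp.toLp 2
      ![w 1 * x 2 - w 2 * x 1, w 2 * x 0 - w 0 * x 2, w 0 * x 1 - w 1 * x 0] := by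
  simp [infRot, cross_apply]

theorem inner_infRot (w : Fin 3 → ℝ) (x : Pt 3) : inner ℝ x (infRot w x) = 0 := by
  rw [infRot_apply]
  simp [PiLp.inner_apply, Fin.sum_univ_three]
  ring

theorem rank_eq_sub_iff_injective {V : Type*} [Fintype V] [DecidableEq V] (M : Matrix V V ℝ)
    {k : ℕ} (P : (V → ℝ) →ₗ[ℝ] (Fin k → ℝ))
    (hP : ∀ s, ∃ x, M.mulVec x = 0 ∧ P x = s) :
    M.rank = Fintype.card V - k ↔ ∀ x, M.mulVec x = 0 → P x = 0 → x = 0 := by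
  set K := LinearMap.ker M.mulVecLin with hK
  have hrank : M.rank + Module.finrank ℝ K = Fintype.card V := by
    simpa [Matrix.rank] using LinearMap.finrank_range_add_finrank_ker M.mulVecLin
  have hsurj : Function.Surjective (P.domRestrict K) := fun s => by
    obtain ⟨x, hx, hs⟩ := hP s
    exact ⟨⟨x, by simpa [hK] using hx⟩, hs⟩
  have hnull := LinearMap.finrank_range_add_finrank_ker (P.domRestrict K)
  rw [LinearMap.range_eq_top.2 hsurj, finrank_top, Module.finrank_fin_fun] at hnull
  have hinj : (∀ x, M.mulVec x = 0 → P x = 0 → x = 0) ↔ LinearMap.ker (P.domRestrict K) = ⊥ := by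
    rw [LinearMap.ker_eq_bot']
    constructor
    · rintro h ⟨x, hx⟩ hPx
      exact Subtype.ext (h x (by simpa [hK] using hx) hPx)
    · intro h x hx hPx
      exact congrArg Subtype.val (h ⟨x, by simpa [hK] using hx⟩ hPx)
  rw [hinj, ← Submodule.finrank_eq_zero (R := ℝ)]
  omega

theorem submatrix_mulVec_eq {V : Type*} [Fintype V] (M : Matrix V V ℝ) (p : V → Prop)
    [DecidablePred p] (x : V → ℝ) (hx : ∀ v, ¬ p v → x v = 0) (r : {v // p v}) :
    (M.submatrix (Subtype.val : {v // p v} → V) (Subtype.val : {v // p v} → V)).mulVec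
      (fun v => x v.1) r = M.mulVec x r.1 := by
  have h := Fintype.sum_subtype_add_sum_subtype p fun v => M r.1 v * x v
  rw [Finset.sum_eq_zero (s := (Finset.univ : Finset {v // ¬ p v}))
    (fun v _ => by rw [hx v.1 v.2, mul_zero]), add_zero] at h
  exact h

/-- for a spatial nCC with the normalization `y_{n−1} = z_{n−1} = z_{n−2} = 0`
and the non-degeneracy conditions on coordinates, `rank(DF(q)) = 3n − 3` iff `D RS` is
invertible. -/
theorem stmt11 {n : ℕ} (hn : 4 ≤ n) (m : Fin n → ℝ) (hm : ∀ i, 0 < m i)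
    (qbar : Fin (n - 1) → Pt 3) (hcc : IsNCC m (extendConfig m qbar))
    (hy1 : qbar ⟨n - 2, by omega⟩ 1 = 0) (hz1 : qbar ⟨n - 2, by omega⟩ 2 = 0)
    (hz2 : qbar ⟨n - 3, by omega⟩ 2 = 0)
    (hx1 : qbar ⟨n - 2, by omega⟩ 0 - extendConfig m qbar ⟨n - 1, by omega⟩ 0 ≠ 0)
    (hx2 : qbar ⟨n - 2, by omega⟩ 0 ≠ 0)
    (hy2 : qbar ⟨n - 3, by omega⟩ 1 ≠ 0)
    (hdet :
      (!![qbar ⟨n - 3, by omega⟩ 1 - extendConfig m qbar ⟨n - 1, by omega⟩ 1,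
          qbar ⟨n - 2, by omega⟩ 1 - extendConfig m qbar ⟨n - 1, by omega⟩ 1;
          qbar ⟨n - 3, by omega⟩ 0 - extendConfig m qbar ⟨n - 1, by omega⟩ 0,
          qbar ⟨n - 2, by omega⟩ 0 - extendConfig m qbar ⟨n - 1, by omega⟩ 0]).det ≠ 0) :
    (jacF m (extendConfig m qbar)).rank = 3 * n - 3 ↔ IsUnit (DRS3 hn m qbar) := by
  classical
  obtain ⟨hcf, -, hF0⟩ := hcc
  set q := extendConfig m qbar with hq
  have hn0 : 0 < n := by omega
  set a : Fin (n - 1) := ⟨n - 2, by omega⟩ with ha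
  set b : Fin (n - 1) := ⟨n - 3, by omega⟩ with hb
  set c : Fin n := ⟨n - 1, by omega⟩ with hc
  have hab : a ≠ b := by
    simp only [ha, hb, ne_eq, Fin.mk.injEq]
    omega
  have hqa : q (emb a) = qbar a := extendConfig_emb m qbar a
  have hqb : q (emb b) = qbar b := extendConfig_emb m qbar b
  have hcard : Fintype.card (Fin n × Fin 3) = 3 * n := by simp [mul_comm]
  let P : (Fin n × Fin 3 → ℝ) →ₗ[ℝ] (Fin 3 → ℝ) := LinearMap.pi
    ![LinearMap.proj (emb a, 1), LinearMap.proj (emb a, 2), LinearMap.proj (emb b, 2)]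
  have hP : ∀ x, P x = ![x (emb a, 1), x (emb a, 2), x (emb b, 2)] := fun x => by
    funext k
    fin_cases k <;> rfl
  have hker : ∀ x, (jacF m q).mulVec x = 0 ↔ fderiv ℝ (nbodyF m) q (ofCoords x) = 0 := fun x => by
    constructor
    · intro h
      funext i
      ext k
      rw [← jacF_mulVec m hcf x (i, k), h]
      rfl
    · intro h
      funext p
      rw [jacF_mulVec m hcf, h]
      rfl
  rw [← hcard, rank_eq_sub_iff_injective (jacF m q) P, ← Matrix.mulVec_injective_iff_isUnit,
    ← Matrix.coe_mulVecLin (DRS3 hn m qbar), ← LinearMap.ker_eq_bot, LinearMap.ker_eq_bot']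
  · constructor
    · intro h w hw
      let x : Fin (n - 1) × Fin 3 → ℝ := fun p =>
        if hp : p ≠ (a, 1) ∧ p ≠ (a, 2) ∧ p ≠ (b, 2) then w ⟨p, hp⟩ else 0
      have hx0 : ∀ p, ¬ (p ≠ (a, 1) ∧ p ≠ (a, 2) ∧ p ≠ (b, 2)) → x p = 0 := fun p hp => dif_neg hp
      have hxw : ∀ p, x p.1 = w p := fun p => dif_pos p.2
      set v := extendConfig m (ofCoords x) with hv
      set u := fderiv ℝ (nbodyF m) q v with hu
      have hrow : ∀ p : Fin (n - 1) × Fin 3, p ≠ (a, 1) ∧ p ≠ (a, 2) ∧ p ≠ (b, 2) →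
          u (emb p.1) p.2 = 0 := fun p hp => by
        rw [hu, hv, ← jacFred_mulVec m hcf, ← submatrix_mulVec_eq _ _ x hx0 ⟨p, hp⟩]
        have := congrFun hw ⟨p, hp⟩
        rw [show w = fun p => x p.1 from funext fun p => (hxw p).symm] at this
        exact this
      have hu0 : u = 0 := by
        have hsum : ∀ f : Fin n → ℝ, (∀ i, i ≠ a → i ≠ b → f (emb i) = 0) →
            ∑ i, f i = f (emb a) + f (emb b) + f c := fun f hf => by
          rw [sum_univ_emb hn0, Finset.sum_eq_add a b hab (fun i _ hi => hf i hi.1 hi.2)] <;> simp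
        have hrest : ∀ i, i ≠ a → i ≠ b → u (emb i) = 0 := fun i hia hib => by
          ext k
          exact hrow (i, k) (by simp [hia, hib])
        have ha0 : u (emb a) 0 = 0 := hrow (a, 0) (by simp)
        have hb0 : u (emb b) 0 = 0 := hrow (b, 0) (by simp)
        have hb1 : u (emb b) 1 = 0 := hrow (b, 1) (by simp [hab.symm])
        have hmom : ∀ k, m (emb a) * u (emb a) k + m (emb b) * u (emb b) k + m c * u c k = 0 :=
          fun k => by
            have h1 := sum_smul_fderiv_nbodyF m hcf v
            rw [hv, sum_smul_extendConfig hn0 m hm, neg_zero, ← hv, ← hu] at h1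
            have h2 := congrArg (fun f : Pt 3 => f k) h1
            simp only [WithLp.ofLp_sum, Finset.sum_apply, PiLp.smul_apply, smul_eq_mul,
              PiLp.zero_apply] at h2
            rwa [hsum _ fun i hia hib => by simp [hrest i hia hib]] at h2
        have hang : ∀ k l, m (emb a) * (q (emb a) k * u (emb a) l - q (emb a) l * u (emb a) k)
            + m (emb b) * (q (emb b) k * u (emb b) l - q (emb b) l * u (emb b) k)
            + m c * (q c k * u c l - q c l * u c k) = 0 := fun k l => by
          have h1 := sum_angular_fderiv_nbodyF m hcf hF0 v k l
          rw [← hu] at h1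
          rwa [hsum _ fun i hia hib => by simp [hrest i hia hib]] at h1
        have hma := (hm (emb a)).ne'
        have hmb := (hm (emb b)).ne'
        have hmc := (hm c).ne'
        rw [Matrix.det_fin_two_of, ← hqa, ← hqb] at hdet
        rw [← hqa] at hx1
        have h0 := hmom 0
        have h1 := hmom 1
        have h2 := hmom 2
        have h01 := hang 0 1
        have h02 := hang 0 2
        have h12 := hang 1 2
        rw [ha0, hb0] at h0 h01 h02
        rw [hb1] at h1 h01 h12
        have hc0 : u c 0 = 0 := by simpa [hmc] using h0
        rw [hc0] at h01 h02
        have ha1 : u (emb a) 1 = 0 := by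
          have : m (emb a) * (q (emb a) 0 - q c 0) * u (emb a) 1 = 0 := by
            linear_combination h01 - q c 0 * h1
          simpa [hma, hx1] using this
        rw [ha1] at h1 h12
        have hc1 : u c 1 = 0 := by simpa [hmc] using h1
        rw [hc1] at h12
        have e1 : m (emb a) * (q (emb a) 0 - q c 0) * u (emb a) 2
            + m (emb b) * (q (emb b) 0 - q c 0) * u (emb b) 2 = 0 := by
          linear_combination h02 - q c 0 * h2
        have e2 : m (emb a) * (q (emb a) 1 - q c 1) * u (emb a) 2
            + m (emb b) * (q (emb b) 1 - q c 1) * u (emb b) 2 = 0 := by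
          linear_combination h12 - q c 1 * h2
        have ha2 : u (emb a) 2 = 0 := by
          refine (mul_eq_zero.1 (?_ : (m (emb a) * _) * u (emb a) 2 = 0)).resolve_left
            (mul_ne_zero hma hdet)
          linear_combination (q (emb b) 1 - q c 1) * e1 - (q (emb b) 0 - q c 0) * e2
        have hb2 : u (emb b) 2 = 0 := by
          refine (mul_eq_zero.1 (?_ : (m (emb b) * _) * u (emb b) 2 = 0)).resolve_left
            (mul_ne_zero hmb hdet)
          linear_combination (q (emb a) 0 - q c 0) * e2 - (q (emb a) 1 - q c 1) * e1
        have hc2 : u c 2 = 0 := by simpa [ha2, hb2, hmc] using h2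
        have hua : u (emb a) = 0 := by
          ext k
          fin_cases k
          exacts [ha0, ha1, ha2]
        have hub : u (emb b) = 0 := by
          ext k
          fin_cases k
          exacts [hb0, hb1, hb2]
        have huc : u c = 0 := by
          ext k
          fin_cases k
          exacts [hc0, hc1, hc2]
        funext i
        by_cases hi : (i : ℕ) < n - 1
        · change u (emb ⟨i, hi⟩) = 0
          by_cases hia : (⟨i, hi⟩ : Fin (n - 1)) = a
          · rw [hia, hua]
          by_cases hib : (⟨i, hi⟩ : Fin (n - 1)) = b
          · rw [hib, hub]
          exact hrest _ hia hib
        · rw [show i = c from Fin.ext (by have := i.2; simp only [hc]; omega), huc]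
          rfl
      have hvc : ofCoords (fun p : Fin n × Fin 3 => v p.1 p.2) = v := rfl
      have hz := h (fun p => v p.1 p.2) ((hker _).2 (by rw [hvc, ← hu0])) (by
        rw [hP, hv]
        simp only [extendConfig_emb]
        funext k
        fin_cases k
        · exact hx0 (a, 1) (by simp)
        · exact hx0 (a, 2) (by simp)
        · exact hx0 (b, 2) (by simp))
      funext p
      have := congrFun hz (emb p.1.1, p.1.2)
      rw [← hxw p]
      simpa [hv, extendConfig_emb, ofCoords] using this
    · intro h x hx hPx
      rw [hP] at hPx
      have hA := (hker x).1 hx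
      have hsum : ∑ i, m i • ofCoords x i = 0 := by
        have := sum_smul_fderiv_nbodyF m hcf (ofCoords x)
        rw [hA] at this
        simpa using this.symm
      have hext := extendConfig_comp_emb hn0 m hm _ hsum
      let y : Fin (n - 1) × Fin 3 → ℝ := fun p => x (emb p.1, p.2)
      have hyext : extendConfig m (ofCoords y) = ofCoords x := hext
      have hy0 : ∀ p, ¬ (p ≠ (a, 1) ∧ p ≠ (a, 2) ∧ p ≠ (b, 2)) → y p = 0 := fun p hp => by
        by_cases h1 : p = (a, 1)
        · rw [h1]; exact congrFun hPx 0
        by_cases h2 : p = (a, 2)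
        · rw [h2]; exact congrFun hPx 1
        by_cases h3 : p = (b, 2)
        · rw [h3]; exact congrFun hPx 2
        exact absurd ⟨h1, h2, h3⟩ hp
      have hw := h (fun p => y p.1) (by
        funext r
        refine (submatrix_mulVec_eq (jacFred m qbar) _ y hy0 r).trans ?_
        rw [jacFred_mulVec m hcf, hyext, hA]
        rfl)
      have hy : y = 0 := by
        funext p
        by_cases hp : p ≠ (a, 1) ∧ p ≠ (a, 2) ∧ p ≠ (b, 2)
        · exact congrFun hw ⟨p, hp⟩
        · exact hy0 p hp
      have hx' : ofCoords x = 0 := by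
        rw [← hyext, hy]
        exact (extendConfigL 3 m).map_zero
      funext p
      exact congrArg (fun f : Pt 3 => f p.2) (congrFun hx' p.1)
  · intro s
    let w : Fin 3 → ℝ :=
      ![(s 2 - s 1 / qbar a 0 * qbar b 0) / qbar b 1, -(s 1 / qbar a 0), s 0 / qbar a 0]
    refine ⟨fun p => infRot w (q p.1) p.2,
      (hker _).2 (fderiv_nbodyF_skew m hcf hF0 (infRot w) (inner_infRot w)), ?_⟩
    rw [hP]
    simp only [hqa, hqb, infRot_apply]
    funext k
    fin_cases k
    · simp [w, hz1]
      field_simp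
    · simp [w, hy1]
      field_simp
    · simp [w]
      field_simp
      ring
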